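/- Let l ≥ 1 and k_1, …, k_l ≥ 2 be integers. For each i ∈ {1, …, l}, let K_i be a finite Galois extension of ℚ (inside a fixed algebraic closure of ℚ) of odd degree d_i ≥ 3 with discriminant D_i, and suppose gcd(D_i, D_j) = 1 for all i ≠ j. Set m = ∏_{i=1}^{l} (k_i² d_i + k_i)/2 and let K_1⋯K_l be the compositum. Then there exists a sequence of complex coefficients u_n such that Σ_{n=1}^∞ |u_n| n^{−σ} < ∞ for every σ > 1/2, and for all s with Re(s) > 1, Σ_{n=1}^∞ τ_{k_1}^{K_1}(n²) ⋯ τ_{k_l}^{K_l}(n²)/n^s = ζ_{K_1⋯K_l}(s)^m · Σ_{n=1}^∞ u_n/n^s. -/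

import Mathlib

open NumberField Filter Finset

/-- `tauK K k n` is the divisor function `τ_k^K(n)`: the number of `k`-tuples
`(𝔞₁, …, 𝔞ₖ)` of nonzero ideals of the ring of integers of `K` with
`N(𝔞₁) ⋯ N(𝔞ₖ) = n`. -/
noncomputable def tauK (K : Type) [Field K] [NumberField K] (k n : ℕ) : ℕ :=
  Nat.card {a : Fin k → Ideal (𝓞 K) // (∀ i, a i ≠ ⊥) ∧ (∏ i, (a i).absNorm) = n}

/-- `aK K n` is the ideal counting function `a_K(n)`: the number of nonzero ideals of the
ring of integers of `K` with absolute norm `n`. -/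
noncomputable def aK (K : Type) [Field K] [NumberField K] (n : ℕ) : ℕ :=
  Nat.card {I : Ideal (𝓞 K) // I ≠ ⊥ ∧ I.absNorm = n}

/-- The Dedekind zeta function of `K` as a Dirichlet series `ζ_K(s) = ∑ a_K(n) n^{-s}`
(valid in the half-plane of absolute convergence `Re s > 1`, which is where it is used). -/
noncomputable def dzeta (K : Type) [Field K] [NumberField K] (s : ℂ) : ℂ :=
  LSeries (fun n => (aK K n : ℂ)) s

section Analytic

lemma summable_poly_geom (E : ℕ) (r : ℝ) (h0 : 0 ≤ r) (h1 : r < 1) (c : ℕ) :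
    Summable fun j : ℕ => ((j : ℝ) + c) ^ E * r ^ j := by
  have : ∀ j : ℕ, ((j : ℝ) + c) ^ E * r ^ j =
      ∑ i ∈ Finset.range (E + 1), ((c : ℝ) ^ (E - i) * (E.choose i : ℝ)) * ((j : ℝ) ^ i * r ^ j) := by
    intro j
    rw [add_pow, Finset.sum_mul]
    refine Finset.sum_congr rfl fun i _ => by ring
  simp_rw [this]
  refine summable_sum fun i _ => Summable.mul_left _ ?_
  exact summable_pow_mul_geometric_of_norm_lt_one i (by rwa [Real.norm_of_nonneg h0])

lemma summable_crit (g : ArithmeticFunction ℂ) (hg : g.IsMultiplicative) (C : ℝ) (E : ℕ)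
    (hC : 0 ≤ C)
    (hb : ∀ p : ℕ, p.Prime → ∀ j : ℕ, ‖g (p ^ j)‖ ≤ C * ((j : ℝ) + 1) ^ E) (σ : ℝ) (hσ : 1 / 2 < σ)
    (hp : Summable fun p : ℕ => if p.Prime then ‖g p‖ * (p : ℝ) ^ (-σ) else 0) :
    Summable fun n : ℕ => ‖g n‖ * (n : ℝ) ^ (-σ) := by
  set f : ℕ → ℝ := fun n => ‖g n‖ * (n : ℝ) ^ (-σ) with hf
  have f0 : f 0 = 0 := by simp [hf]
  have f1 : f 1 = 1 := by simp [hf, hg.1]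
  have fnn : ∀ n, 0 ≤ f n := fun n => by simp only [hf]; positivity
  have fmul : ∀ {m n : ℕ}, Nat.Coprime m n → f (m * n) = f m * f n := by
    intro m n h
    simp only [hf]
    rw [hg.2 h, norm_mul, Nat.cast_mul, Real.mul_rpow (by positivity) (by positivity)]
    ring
  set r : ℝ := (2 : ℝ) ^ (-(1 / 2) : ℝ) with hr
  have r0 : 0 ≤ r := by positivity
  have r1 : r < 1 := by
    rw [hr]; exact Real.rpow_lt_one_of_one_lt_of_neg (by norm_num) (by norm_num)
  have hx : ∀ p : ℕ, p.Prime → (p : ℝ) ^ (-σ) ≤ r := by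
    intro p hp
    have h2 : (2 : ℝ) ≤ p := by exact_mod_cast hp.two_le
    calc (p : ℝ) ^ (-σ) ≤ (2 : ℝ) ^ (-σ) :=
          Real.rpow_le_rpow_of_nonpos (by norm_num) h2 (by linarith)
      _ ≤ r := Real.rpow_le_rpow_of_exponent_le (by norm_num) (by linarith)
  have hxp : ∀ p : ℕ, ∀ j : ℕ, ((p ^ j : ℕ) : ℝ) ^ (-σ) = ((p : ℝ) ^ (-σ)) ^ j := by
    intro p j
    rw [Nat.cast_pow, ← Real.rpow_natCast, ← Real.rpow_natCast, ← Real.rpow_mul (by positivity),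
      ← Real.rpow_mul (by positivity), mul_comm]
  have fpj : ∀ p : ℕ, p.Prime → ∀ j : ℕ, f (p ^ j) ≤ C * ((j : ℝ) + 1) ^ E * ((p : ℝ) ^ (-σ)) ^ j := by
    intro p hp j
    simp only [hf]
    rw [hxp]
    gcongr
    exact hb p hp j
  have hsum1 : ∀ {p : ℕ}, p.Prime → Summable (fun n : ℕ => f (p ^ n)) := by
    intro p hp
    have := (summable_poly_geom E r r0 r1 1).mul_left C
    refine Summable.of_nonneg_of_le (fun _ => fnn _) (fun j => (fpj p hp j).trans ?_) this
    rw [mul_assoc]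
    push_cast
    gcongr
    exact hx p hp
  have hS := (summable_poly_geom E r r0 r1 3).mul_left C
  set S := ∑' j : ℕ, C * (((j : ℝ) + (3 : ℕ)) ^ E * r ^ j) with hSdef
  have hS0 : 0 ≤ S := tsum_nonneg fun j => by positivity
  set ε : ℕ → ℝ := fun n => (if n.Prime then f n else 0) + S * (n : ℝ) ^ (-(2 * σ)) with hε
  have hεnn : ∀ n, 0 ≤ ε n := by
    intro n
    simp only [hε]
    have := fnn n
    have : 0 ≤ S * (n : ℝ) ^ (-(2 * σ)) := by positivity
    split_ifs <;> linarith
  have hεs : Summable ε := by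
    refine Summable.add hp (Summable.mul_left _ ?_)
    exact Real.summable_nat_rpow.mpr (by linarith)
  have hloc : ∀ p : ℕ, p.Prime → ∑' n : ℕ, f (p ^ n) ≤ Real.exp (ε p) := by
    intro p hp
    have hs := hsum1 hp
    rw [← hs.sum_add_tsum_nat_add 2]
    have h1 : ∑ i ∈ Finset.range 2, f (p ^ i) = 1 + f p := by
      simp [Finset.sum_range_succ, f1]
    have h2 : ∑' i : ℕ, f (p ^ (i + 2)) ≤ S * (p : ℝ) ^ (-(2 * σ)) := by
      rw [hSdef, ← tsum_mul_right]
      refine Summable.tsum_le_tsum (fun i => ?_) ((summable_nat_add_iff 2).mpr hs)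
        (hS.mul_right _)
      refine (fpj p hp (i + 2)).trans ?_
      have e : (p : ℝ) ^ (-(2 * σ)) = ((p : ℝ) ^ (-σ)) ^ 2 := by
        rw [← Real.rpow_natCast, ← Real.rpow_mul (by positivity)]
        congr 1
        push_cast
        ring
      rw [e, pow_add ((p : ℝ) ^ (-σ)), ← mul_assoc, ← mul_assoc]
      have := hx p hp
      have e2 : (((i + 2 : ℕ) : ℝ) + 1) = (i : ℝ) + (3 : ℕ) := by push_cast; ring
      rw [e2]
      gcongr
    rw [h1]
    have h3 : ε p = f p + S * (p : ℝ) ^ (-(2 * σ)) := by simp [hε, hp]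
    have := Real.add_one_le_exp (ε p)
    linarith
  refine summable_of_sum_range_le (c := Real.exp (∑' n, ε n)) fnn fun N => ?_
  have key := (EulerProduct.summable_and_hasSum_smoothNumbers_prod_primesBelow_tsum (f := f) f1
    fmul (fun hp => by simpa [Real.norm_of_nonneg (fnn _)] using hsum1 hp) N).2
  have key2 : HasSum (Set.indicator (N.smoothNumbers) f) (∏ p ∈ N.primesBelow, ∑' n : ℕ, f (p ^ n)) :=
    hasSum_subtype_iff_indicator.mp key
  calc ∑ i ∈ Finset.range N, f i ≤ ∑ i ∈ Finset.range N, Set.indicator (N.smoothNumbers) f i := by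
        refine Finset.sum_le_sum fun i hi => ?_
        rcases Nat.eq_zero_or_pos i with rfl | h
        · rw [f0]; exact Set.indicator_nonneg (fun x _ => fnn x) _
        · rw [Set.indicator_of_mem]
          exact Nat.mem_smoothNumbers_of_lt h (Finset.mem_range.mp hi)
    _ ≤ ∏ p ∈ N.primesBelow, ∑' n : ℕ, f (p ^ n) :=
        sum_le_hasSum _ (fun i _ => Set.indicator_nonneg (fun x _ => fnn x) _) key2
    _ ≤ ∏ p ∈ N.primesBelow, Real.exp (ε p) := by
        refine Finset.prod_le_prod (fun p _ => tsum_nonneg fun _ => fnn _) fun p hp => ?_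
        exact hloc p (Nat.prime_of_mem_primesBelow hp)
    _ = Real.exp (∑ p ∈ N.primesBelow, ε p) := (Real.exp_sum _ _).symm
    _ ≤ _ := Real.exp_le_exp.mpr (hεs.sum_le_tsum _ fun i _ => hεnn i)

lemma lseriesSummable_of_real (g : ArithmeticFunction ℂ) (s : ℂ)
    (h : Summable fun n : ℕ => ‖g n‖ * (n : ℝ) ^ (-s.re)) : LSeriesSummable (fun n => g n) s := by
  refine Summable.of_norm ?_
  refine h.congr fun n => ?_
  rw [LSeries.norm_term_eq]
  split_ifs with hn
  · simp [hn]
  · rw [Real.rpow_neg (by positivity), div_eq_mul_inv]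

/-- polynomial bounds for power series coefficients -/
def PBd (g : PowerSeries ℂ) (C : ℝ) (E : ℕ) : Prop :=
  ∀ j : ℕ, ‖PowerSeries.coeff j g‖ ≤ C * ((j : ℝ) + 1) ^ E

lemma PBd.mul {g h : PowerSeries ℂ} {C D : ℝ} {E F : ℕ} (hC : 0 ≤ C) (hg : PBd g C E)
    (hh : PBd h D F) : PBd (g * h) (C * D) (E + F + 1) := by
  intro n
  rw [PowerSeries.coeff_mul]
  refine (norm_sum_le _ _).trans ?_
  have : ∀ x ∈ Finset.HasAntidiagonal.antidiagonal n, ‖PowerSeries.coeff x.1 g * PowerSeries.coeff x.2 h‖ ≤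
      C * D * ((n : ℝ) + 1) ^ (E + F) := by
    intro x hx
    rw [Finset.HasAntidiagonal.mem_antidiagonal] at hx
    have h1 : (x.1 : ℝ) ≤ n := by exact_mod_cast (by omega : x.1 ≤ n)
    have h2 : (x.2 : ℝ) ≤ n := by exact_mod_cast (by omega : x.2 ≤ n)
    have hD : 0 ≤ D * ((x.2 : ℝ) + 1) ^ F := (norm_nonneg _).trans (hh x.2)
    have hD' : 0 ≤ D := by
      by_contra hlt
      have : 0 < ((x.2 : ℝ) + 1) ^ F := by positivity
      nlinarith
    rw [norm_mul]
    calc _ ≤ (C * ((x.1 : ℝ) + 1) ^ E) * (D * ((x.2 : ℝ) + 1) ^ F) := by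
          gcongr
          · exact hg _
          · exact hh _
      _ ≤ (C * ((n : ℝ) + 1) ^ E) * (D * ((n : ℝ) + 1) ^ F) := by gcongr
      _ = _ := by rw [pow_add]; ring
  refine (Finset.sum_le_sum this).trans (le_of_eq ?_)
  rw [Finset.sum_const, Finset.Nat.card_antidiagonal, nsmul_eq_mul, pow_succ]
  push_cast
  ring

lemma PBd.mono {g : PowerSeries ℂ} {C : ℝ} {E F : ℕ} (hC : 0 ≤ C) (hg : PBd g C E) (h : E ≤ F) :
    PBd g C F := by
  intro j
  refine (hg j).trans ?_
  gcongr
  have : (0 : ℝ) ≤ j := by positivity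
  linarith

lemma PBd.one : PBd 1 1 0 := by
  intro j
  rw [PowerSeries.coeff_one]
  split_ifs <;> simp

lemma PBd.prod {ι : Type*} (s : Finset ι) (g : ι → PowerSeries ℂ) (E : ℕ)
    (h : ∀ i ∈ s, PBd (g i) 1 E) : PBd (∏ i ∈ s, g i) 1 (s.card * (E + 1)) := by
  classical
  induction s using Finset.induction_on with
  | empty => simpa using PBd.one
  | insert a s ha ih =>
    rw [Finset.prod_insert ha, Finset.card_insert_of_notMem ha]
    have := PBd.mul (zero_le_one) (h a (by simp)) (ih fun i hi => h i (by simp [hi]))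
    rw [mul_one] at this
    convert this using 1
    ring

lemma PBd.pow {g : PowerSeries ℂ} {E : ℕ} (h : PBd g 1 E) (k : ℕ) : PBd (g ^ k) 1 (k * (E + 1)) := by
  have := PBd.prod (Finset.range k) (fun _ => g) E (fun _ _ => h)
  simpa using this

/-- the local series at `p` of an arithmetic function -/
noncomputable def locS (g : ArithmeticFunction ℂ) (p : ℕ) : PowerSeries ℂ :=
  PowerSeries.mk fun j => g (p ^ j)

lemma locS_mul (g h : ArithmeticFunction ℂ) {p : ℕ} (hp : p.Prime) :
    locS (g * h) p = locS g p * locS h p := by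
  ext j
  rw [PowerSeries.coeff_mul]
  simp only [locS, PowerSeries.coeff_mk]
  rw [ArithmeticFunction.mul_apply, Nat.sum_divisorsAntidiagonal (fun a b => g a * h b),
    Nat.sum_divisors_prime_pow hp, Finset.Nat.sum_antidiagonal_eq_sum_range_succ_mk]
  refine Finset.sum_congr rfl fun i hi => ?_
  rw [Nat.pow_div (by simpa [Nat.lt_succ_iff] using hi) hp.pos]

lemma locS_one {p : ℕ} (hp : p.Prime) : locS 1 p = 1 := by
  ext j
  simp only [locS, PowerSeries.coeff_mk, PowerSeries.coeff_one, ArithmeticFunction.one_apply]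
  simp [hp.ne_one]

lemma locS_pow (g : ArithmeticFunction ℂ) {p : ℕ} (hp : p.Prime) (k : ℕ) :
    locS (g ^ k) p = locS g p ^ k := by
  induction k with
  | zero => simp [locS_one hp]
  | succ k ih => rw [pow_succ, locS_mul _ _ hp, ih, pow_succ]

lemma isMult_pow {g : ArithmeticFunction ℂ} (hg : g.IsMultiplicative) (k : ℕ) :
    (g ^ k).IsMultiplicative := by
  induction k with
  | zero => simp [ArithmeticFunction.isMultiplicative_one]
  | succ k ih => rw [pow_succ]; exact ih.mul hg

lemma exists_mult_of_local (b : ℕ → PowerSeries ℂ) (hb : ∀ p, p.Prime → PowerSeries.coeff 0 (b p) = 1) :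
    ∃ B : ArithmeticFunction ℂ, B.IsMultiplicative ∧ ∀ p, p.Prime → locS B p = b p := by
  let B : ArithmeticFunction ℂ := ⟨fun n => if n = 0 then 0 else
    n.factorization.prod fun p j => PowerSeries.coeff j (b p), by simp⟩
  have hB : ∀ n, n ≠ 0 → B n = n.factorization.prod fun p j => PowerSeries.coeff j (b p) := by
    intro n hn
    simp [B, hn]
  refine ⟨B, ⟨by simp [hB], ?_⟩, ?_⟩
  · intro m n hmn
    rcases eq_or_ne m 0 with rfl | hm
    · simp
    rcases eq_or_ne n 0 with rfl | hn
    · simp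
    rw [hB _ (mul_ne_zero hm hn), hB _ hm, hB _ hn, Nat.factorization_mul hm hn]
    refine Finsupp.prod_add_index_of_disjoint ?_ _
    exact hmn.disjoint_primeFactors
  · intro p hp
    ext j
    rw [locS, PowerSeries.coeff_mk, hB _ (pow_ne_zero _ hp.ne_zero), hp.factorization_pow,
      Finsupp.prod_single_index (hb p hp)]

lemma exists_dirichlet_inverse (A : ArithmeticFunction ℂ) (hA : A.IsMultiplicative)
    (b : ℕ → PowerSeries ℂ) (hb : ∀ p, p.Prime → PowerSeries.coeff 0 (b p) = 1)
    (h : ∀ p, p.Prime → locS A p * b p = 1) :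
    ∃ B : ArithmeticFunction ℂ, B.IsMultiplicative ∧ (∀ p, p.Prime → locS B p = b p) ∧ A * B = 1 := by
  obtain ⟨B, hB, hBl⟩ := exists_mult_of_local b hb
  refine ⟨B, hB, hBl, ?_⟩
  rw [ArithmeticFunction.IsMultiplicative.eq_iff_eq_on_prime_powers _ (hA.mul hB) _
    ArithmeticFunction.isMultiplicative_one]
  intro p j hp
  have := congrArg (PowerSeries.coeff j) (locS_mul A B hp)
  rw [hBl p hp, h p hp, ← locS_one hp] at this
  simpa [locS] using this

end Analytic

section Counting

/-- the geometric series `1/(1-X^f)` -/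
noncomputable def geomS (f : ℕ) : PowerSeries ℂ := PowerSeries.mk fun j => if f ∣ j then 1 else 0

lemma geomS_mul (f : ℕ) (hf : 0 < f) : geomS f * (1 - PowerSeries.X ^ f) = 1 := by
  ext j
  rw [mul_sub, mul_one, map_sub, PowerSeries.coeff_mul_X_pow', PowerSeries.coeff_one]
  simp only [geomS, PowerSeries.coeff_mk]
  by_cases h : f ≤ j
  · have h0 : j ≠ 0 := by omega
    simp only [h, if_true, h0, if_false, Nat.dvd_sub_self_right]
    split_ifs with h1 h2 h2
    · simp
    · exact absurd (Or.inl h1) h2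
    · rcases h2 with h2 | h2
      · exact absurd h2 h1
      · have : j = f := by omega
        exact absurd (this ▸ dvd_rfl) h1
    · simp
  · simp only [h, if_false, sub_zero]
    rcases eq_or_ne j 0 with rfl | h0
    · simp
    · have : ¬ f ∣ j := fun hd => h (Nat.le_of_dvd (by omega) hd)
      simp [h0, this]

lemma card_multiset_eq_coeff {ι : Type*} [Fintype ι] (f : ι → ℕ) (hf : ∀ i, 0 < f i) (j : ℕ) :
    (Nat.card {m : Multiset ι // (m.map f).sum = j} : ℂ) =
      PowerSeries.coeff j (∏ i, geomS (f i)) := by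
  classical
  rw [PowerSeries.coeff_prod]
  have h1 : ∀ l : ι →₀ ℕ, ∏ i, PowerSeries.coeff (l i) (geomS (f i)) =
      if ∀ i, f i ∣ l i then (1 : ℂ) else 0 := by
    intro l
    simp only [geomS, PowerSeries.coeff_mk]
    rw [Finset.prod_ite_zero]
    simp
  simp_rw [h1]
  rw [← Finset.sum_filter, Finset.sum_const, nsmul_eq_mul, mul_one]
  congr 1
  rw [← Nat.card_eq_finsetCard]
  have hsum : ∀ m : Multiset ι, (m.map f).sum = ∑ i, m.count i * f i := by
    intro m
    rw [Finset.sum_multiset_map_count]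
    simp only [smul_eq_mul]
    refine Finset.sum_subset (Finset.subset_univ _) fun i _ hi => ?_
    rw [Multiset.mem_toFinset] at hi
    simp [Multiset.count_eq_zero_of_notMem hi]
  refine Nat.card_congr (Equiv.ofBijective (fun m => ⟨Finsupp.equivFunOnFinite.symm
    fun i => m.1.count i * f i, ?_⟩) ⟨?_, ?_⟩)
  · have := hsum m.1
    rw [m.2] at this
    simp [Finset.mem_finsuppAntidiag, ← this]
  · intro m m' h
    ext i
    have h2 := congrArg (fun l => l.1 i) h
    simp only [Finsupp.equivFunOnFinite_symm_apply_apply] at h2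
    exact Nat.eq_of_mul_eq_mul_right (hf i) h2
  · rintro ⟨l, hl⟩
    simp only [Finset.mem_filter, Finset.mem_finsuppAntidiag] at hl
    have hc : ∀ i, (Finsupp.toMultiset (Finsupp.equivFunOnFinite.symm fun i => l i / f i)).count i
        = l i / f i := by
      intro i
      rw [Finsupp.count_toMultiset]
      simp
    refine ⟨⟨Finsupp.toMultiset (Finsupp.equivFunOnFinite.symm fun i => l i / f i), ?_⟩, ?_⟩
    · rw [hsum]
      simp_rw [hc, Nat.div_mul_cancel (hl.2 _)]
      exact hl.1.1
    · ext i
      simp only [Finsupp.equivFunOnFinite_symm_apply_apply]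
      rw [hc, Nat.div_mul_cancel (hl.2 _)]

variable (K : Type) [Field K] [NumberField K]

/-- primes above `p` -/
abbrev PO (p : ℕ) : Set (Ideal (𝓞 K)) := (Ideal.span {(p : ℤ)}).primesOver (𝓞 K)

lemma finite_PO (p : ℕ) : (PO K p).Finite := Algebra.QuasiFinite.finite_primesOver _

noncomputable instance (p : ℕ) : Fintype (PO K p) := (finite_PO K p).fintype

lemma PO_norm {p : ℕ} (P : PO K p) : P.1.absNorm = p ^ P.1.inertiaDeg ℤ := by
  have := P.2.1
  have := P.2.2
  rw [← Ideal.absNorm_pow_inertiaDeg (Ideal.span {(p : ℤ)}) P.1]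
  simp

lemma PO_deg_pos {p : ℕ} (P : PO K p) : 0 < P.1.inertiaDeg ℤ := by
  have := P.2.1
  exact P.1.inertiaDeg_pos ℤ

lemma PO_ne_bot {p : ℕ} (hp : p.Prime) (P : PO K p) : P.1 ≠ ⊥ := by
  intro h
  have h1 := PO_norm K P
  rw [h, Ideal.absNorm_bot] at h1
  exact pow_ne_zero _ hp.ne_zero h1.symm

lemma mem_PO_of_dvd {p : ℕ} (hp : p.Prime) {P : Ideal (𝓞 K)} (hP : P.IsPrime) {j : ℕ}
    (h : P.absNorm ∣ p ^ j) : P ∈ PO K p := by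
  refine ⟨hP, ?_⟩
  rw [Ideal.liesOver_span_iff hP.ne_top (Nat.prime_iff_prime_int.mp hp)]
  have h1 : ((p ^ j : ℕ) : 𝓞 K) ∈ P := by
    obtain ⟨c, hc⟩ := h
    rw [hc, Nat.cast_mul]
    exact P.mul_mem_right _ P.absNorm_mem
  rw [Nat.cast_pow] at h1
  simpa using hP.mem_of_pow_mem _ h1

open UniqueFactorizationMonoid in
lemma aK_prime_pow {p : ℕ} (hp : p.Prime) (j : ℕ) :
    (aK K (p ^ j) : ℂ) = PowerSeries.coeff j (∏ P : PO K p, geomS (P.1.inertiaDeg ℤ)) := by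
  classical
  rw [← card_multiset_eq_coeff _ (fun P => PO_deg_pos K P), aK]
  congr 1
  symm
  have hpr : ∀ m : Multiset (PO K p), ∀ q ∈ m.map (fun P => P.1), Prime q := by
    intro m q hq
    obtain ⟨P, _, rfl⟩ := Multiset.mem_map.mp hq
    exact Ideal.prime_of_isPrime (PO_ne_bot K hp P) P.2.1
  have hN : ∀ m : Multiset (PO K p), Ideal.absNorm (m.map (fun P : PO K p => P.1)).prod =
      p ^ (m.map (fun P => P.1.inertiaDeg ℤ)).sum := by
    intro m
    induction m using Multiset.induction_on with
    | empty => simp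
    | cons a m ih =>
      simp only [Multiset.map_cons, Multiset.prod_cons, Multiset.sum_cons, map_mul, ih, pow_add,
        PO_norm K a]
  refine Nat.card_congr (Equiv.ofBijective (fun m => ⟨(m.1.map (fun P => P.1)).prod, ?_, ?_⟩) ⟨?_, ?_⟩)
  · intro h
    have := hN m.1
    rw [h, Ideal.absNorm_bot] at this
    exact pow_ne_zero _ hp.ne_zero this.symm
  · rw [hN, m.2]
  · intro m m' h
    have h1 := congrArg (fun I => normalizedFactors I.1) h
    simp only at h1
    rw [normalizedFactors_prod_of_prime (hpr _), normalizedFactors_prod_of_prime (hpr _)] at h1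
    exact Subtype.ext (Multiset.map_injective Subtype.val_injective h1)
  · rintro ⟨I, hI, hIN⟩
    have h1 : ∀ P ∈ normalizedFactors I, P ∈ PO K p := by
      intro P hP
      refine mem_PO_of_dvd K hp (Ideal.isPrime_of_prime (prime_of_normalized_factor P hP)) (j := j) ?_
      rw [← hIN]
      exact map_dvd _ (dvd_of_mem_normalizedFactors hP)
    obtain ⟨m, hm⟩ : ∃ m : Multiset (PO K p), m.map (fun P => P.1) = normalizedFactors I := by
      generalize normalizedFactors I = s at h1
      lift s to Multiset (PO K p) using h1
      exact ⟨s, rfl⟩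
    have h2 : (m.map (fun P => P.1)).prod = I := by
      rw [hm]; exact Ideal.prod_normalizedFactors_eq_self hI
    refine ⟨⟨m, ?_⟩, Subtype.ext h2⟩
    have := hN m
    rw [h2, hIN] at this
    exact (Nat.pow_right_injective hp.two_le this).symm

lemma finite_aK (n : ℕ) : Finite {I : Ideal (𝓞 K) // I ≠ ⊥ ∧ I.absNorm = n} :=
  ((Ideal.finite_setOfPred_absNorm_eq (S := 𝓞 K) n).subset fun _ h => h.2).to_subtype

lemma aK_zero : aK K 0 = 0 := by
  rw [aK]
  have : IsEmpty {I : Ideal (𝓞 K) // I ≠ ⊥ ∧ I.absNorm = 0} :=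
    ⟨fun I => I.2.1 (Ideal.absNorm_eq_zero_iff.mp I.2.2)⟩
  simp

lemma aK_one : aK K 1 = 1 := by
  rw [aK, Nat.card_eq_one_iff_unique]
  refine ⟨⟨fun a b => Subtype.ext ?_⟩, ⟨⟨⊤, by simp, by simp⟩⟩⟩
  rw [Ideal.absNorm_eq_one_iff.mp a.2.2, Ideal.absNorm_eq_one_iff.mp b.2.2]

/-- the ideal counting function as an arithmetic function -/
noncomputable def AK : ArithmeticFunction ℂ := ⟨fun n => (aK K n : ℂ), by simp [aK_zero]⟩

lemma AK_apply (n : ℕ) : AK K n = (aK K n : ℂ) := rfl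

lemma sup_span_eq {m n : ℕ} (h : m.Coprime n) {I J : Ideal (𝓞 K)} (hI : (m : 𝓞 K) ∈ I)
    (hJ : (n : 𝓞 K) ∈ J) : I * J ⊔ Ideal.span {(m : 𝓞 K)} = I := by
  apply le_antisymm
  · exact sup_le Ideal.mul_le_left ((Ideal.span_singleton_le_iff_mem _).mpr hI)
  · intro x hx
    obtain ⟨a, b, hab⟩ := Nat.isCoprime_iff_coprime.mpr h
    have h1 : x = x * (b * n) + (a * x) * m := by
      have : ((a * m + b * n : ℤ) : 𝓞 K) = 1 := by rw [hab]; simp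
      push_cast at this
      linear_combination (-x) * this
    rw [h1]
    refine Submodule.add_mem_sup (Ideal.mul_mem_mul hx (J.mul_mem_left _ hJ)) ?_
    exact Ideal.mul_mem_left _ _ (Ideal.mem_span_singleton_self _)

lemma aK_mul {m n : ℕ} (h : m.Coprime n) : aK K (m * n) = aK K m * aK K n := by
  rcases eq_or_ne m 0 with rfl | hm
  · simp [aK_zero]
  rcases eq_or_ne n 0 with rfl | hn
  · simp [aK_zero]
  rw [aK, aK, aK, ← Nat.card_prod]
  symm
  refine Nat.card_congr (Equiv.ofBijective (fun x => ⟨x.1.1 * x.2.1, ?_, ?_⟩) ⟨?_, ?_⟩)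
  · exact mul_ne_zero x.1.2.1 x.2.2.1
  · rw [map_mul, x.1.2.2, x.2.2.2]
  · rintro ⟨⟨I, hI, hI'⟩, ⟨J, hJ, hJ'⟩⟩ ⟨⟨I2, hI2, hI2'⟩, ⟨J2, hJ2, hJ2'⟩⟩ he
    have he' : I * J = I2 * J2 := congrArg Subtype.val he
    have e1 := sup_span_eq K h (hI' ▸ I.absNorm_mem) (hJ' ▸ J.absNorm_mem)
    have e2 := sup_span_eq K h (hI2' ▸ I2.absNorm_mem) (hJ2' ▸ J2.absNorm_mem)
    have e3 := sup_span_eq K h.symm (hJ' ▸ J.absNorm_mem) (hI' ▸ I.absNorm_mem)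
    have e4 := sup_span_eq K h.symm (hJ2' ▸ J2.absNorm_mem) (hI2' ▸ I2.absNorm_mem)
    rw [he'] at e1
    rw [mul_comm, he', mul_comm] at e3
    have f1 : I = I2 := e1.symm.trans e2
    have f2 : J = J2 := e3.symm.trans e4
    subst f1 f2
    rfl
  · rintro ⟨M, hM, hMN⟩
    set I := M ⊔ Ideal.span {(m : 𝓞 K)} with hI
    set J := M ⊔ Ideal.span {(n : 𝓞 K)} with hJ
    have hmI : (m : 𝓞 K) ∈ I := Ideal.mem_sup_right (Ideal.mem_span_singleton_self _)
    have hnJ : (n : 𝓞 K) ∈ J := Ideal.mem_sup_right (Ideal.mem_span_singleton_self _)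
    have hmn : ((m * n : ℕ) : 𝓞 K) ∈ M := hMN ▸ M.absNorm_mem
    have hIJ : I * J = M := by
      apply le_antisymm
      · rw [hI, hJ, Ideal.sup_mul]
        refine sup_le Ideal.mul_le_left ?_
        refine (Ideal.mul_sup _ _ _).le.trans (sup_le Ideal.mul_le_right ?_)
        rw [Ideal.span_singleton_mul_span_singleton, Ideal.span_singleton_le_iff_mem]
        exact_mod_cast hmn
      · intro x hx
        obtain ⟨a, b, hab⟩ := Nat.isCoprime_iff_coprime.mpr h
        have h1 : x = (a * m) * x + x * (b * n) := by
          have : ((a * m + b * n : ℤ) : 𝓞 K) = 1 := by rw [hab]; simp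
          push_cast at this
          linear_combination (-x) * this
        rw [h1]
        refine add_mem (Ideal.mul_mem_mul (I.mul_mem_left _ hmI) (Ideal.mem_sup_left hx))
          (Ideal.mul_mem_mul (Ideal.mem_sup_left hx) (J.mul_mem_left _ hnJ))
    have hN : I.absNorm * J.absNorm = m * n := by rw [← map_mul, hIJ, hMN]
    have dv : ∀ (L : Ideal (𝓞 K)) (k : ℕ), (k : 𝓞 K) ∈ L →
        L.absNorm ∣ k ^ Module.finrank ℤ (𝓞 K) := by
      intro L k hk
      rw [← Ideal.absNorm_span_natCast]
      exact Ideal.absNorm_dvd_absNorm_of_le ((Ideal.span_singleton_le_iff_mem _).mpr hk)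
    have c1 : I.absNorm.Coprime n := Nat.Coprime.coprime_dvd_left (dv I m hmI) (h.pow_left _)
    have c2 : J.absNorm.Coprime m := Nat.Coprime.coprime_dvd_left (dv J n hnJ) (h.symm.pow_left _)
    have d1 : I.absNorm ∣ m := c1.dvd_of_dvd_mul_right (hN ▸ dvd_mul_right _ _)
    have d2 : J.absNorm ∣ n := c2.dvd_of_dvd_mul_left (hN ▸ dvd_mul_left _ _)
    have n1 : I.absNorm = m := by
      refine Nat.dvd_antisymm d1 ?_
      refine c2.symm.dvd_of_dvd_mul_right (n := J.absNorm) (hN ▸ dvd_mul_right _ _)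
    have n2 : J.absNorm = n := by
      rw [n1] at hN
      exact Nat.eq_of_mul_eq_mul_left (Nat.pos_of_ne_zero hm) hN
    have zI : I ≠ ⊥ := by
      intro hb; rw [hb, Ideal.absNorm_bot] at n1; exact hm n1.symm
    have zJ : J ≠ ⊥ := by
      intro hb; rw [hb, Ideal.absNorm_bot] at n2; exact hn n2.symm
    exact ⟨⟨⟨I, zI, n1⟩, ⟨J, zJ, n2⟩⟩, Subtype.ext hIJ⟩

lemma AK_mult : (AK K).IsMultiplicative := by
  refine ⟨by simp [AK_apply, aK_one], fun {m n} h => ?_⟩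
  simp [AK_apply, aK_mul K h]

lemma finite_tauK (k n : ℕ) (hn : n ≠ 0) :
    Finite {a : Fin k → Ideal (𝓞 K) // (∀ i, a i ≠ ⊥) ∧ (∏ i, (a i).absNorm) = n} := by
  refine Set.Finite.to_subtype (s := {a : Fin k → Ideal (𝓞 K) | (∀ i, a i ≠ ⊥) ∧
    (∏ i, (a i).absNorm) = n}) ?_
  refine (Set.Finite.pi' (t := fun _ : Fin k => {I : Ideal (𝓞 K) | I.absNorm ≤ n})
    fun _ => Ideal.finite_setOfPred_absNorm_le n).subset ?_
  intro a ha i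
  refine Nat.le_of_dvd (Nat.pos_of_ne_zero hn) ?_
  rw [← ha.2]
  exact Finset.dvd_prod_of_mem _ (Finset.mem_univ i)

lemma tauK_succ (k n : ℕ) (hn : n ≠ 0) :
    tauK K (k + 1) n = ∑ x ∈ n.divisorsAntidiagonal, aK K x.1 * tauK K k x.2 := by
  have : ∀ x : n.divisorsAntidiagonal, Finite ({I : Ideal (𝓞 K) // I ≠ ⊥ ∧ I.absNorm = x.1.1} ×
      {a : Fin k → Ideal (𝓞 K) // (∀ i, a i ≠ ⊥) ∧ (∏ i, (a i).absNorm) = x.1.2}) := by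
    intro x
    have := finite_aK K x.1.1
    have h0 : x.1.2 ≠ 0 := by
      have := (Nat.mem_divisorsAntidiagonal.mp x.2)
      intro h; rw [h] at this; simp at this; exact this.2 this.1.symm
    have := finite_tauK K k x.1.2 h0
    infer_instance
  rw [← Finset.sum_coe_sort]
  have e : ∀ x : n.divisorsAntidiagonal, aK K x.1.1 * tauK K k x.1.2 =
      Nat.card ({I : Ideal (𝓞 K) // I ≠ ⊥ ∧ I.absNorm = x.1.1} ×
      {a : Fin k → Ideal (𝓞 K) // (∀ i, a i ≠ ⊥) ∧ (∏ i, (a i).absNorm) = x.1.2}) := by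
    intro x
    rw [Nat.card_prod, aK, tauK]
  simp_rw [e]
  rw [← Nat.card_sigma, tauK]
  refine Nat.card_congr ⟨fun a => ⟨⟨((a.1 0).absNorm, ∏ i : Fin k, (a.1 i.succ).absNorm), ?_⟩,
    ⟨a.1 0, a.2.1 0, rfl⟩, ⟨fun i => a.1 i.succ, fun i => a.2.1 _, rfl⟩⟩,
    fun y => ⟨Fin.cons y.2.1.1 y.2.2.1, ?_, ?_⟩, ?_, ?_⟩
  · rw [Nat.mem_divisorsAntidiagonal]
    refine ⟨?_, hn⟩
    have := a.2.2
    rw [Fin.prod_univ_succ] at this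
    exact this
  · intro i
    refine Fin.cases ?_ (fun i => ?_) i
    · simpa using y.2.1.2.1
    · simpa using y.2.2.2.1 i
  · rw [Fin.prod_univ_succ]
    simp only [Fin.cons_zero, Fin.cons_succ]
    rw [y.2.1.2.2, y.2.2.2.2]
    exact (Nat.mem_divisorsAntidiagonal.mp y.1.2).1
  · intro a
    apply Subtype.ext
    exact Fin.cons_self_tail a.1
  · rintro ⟨⟨⟨x, y⟩, hxy⟩, ⟨I, hI, hI'⟩, ⟨a, ha, ha'⟩⟩
    simp only at hI' ha'
    subst hI' ha'
    rfl

lemma AK_pow_apply (k n : ℕ) (hn : n ≠ 0) : (AK K ^ k) n = (tauK K k n : ℂ) := by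
  induction k generalizing n with
  | zero =>
    rw [pow_zero, ArithmeticFunction.one_apply, tauK]
    split_ifs with h
    · subst h
      have : Nat.card {a : Fin 0 → Ideal (𝓞 K) // (∀ i, a i ≠ ⊥) ∧ (∏ i, (a i).absNorm) = 1} = 1 := by
        rw [Nat.card_eq_one_iff_unique]
        exact ⟨inferInstance, ⟨⟨Fin.elim0, fun i => i.elim0, by simp⟩⟩⟩
      rw [this]; simp
    · have : IsEmpty {a : Fin 0 → Ideal (𝓞 K) // (∀ i, a i ≠ ⊥) ∧ (∏ i, (a i).absNorm) = n} :=
        ⟨fun a => h (by simpa using a.2.2.symm)⟩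
      rw [Nat.card_of_isEmpty]; simp
  | succ k ih =>
    rw [pow_succ', ArithmeticFunction.mul_apply, tauK_succ K k n hn]
    push_cast
    refine Finset.sum_congr rfl fun x hx => ?_
    have hx2 := (Nat.mem_divisorsAntidiagonal.mp hx)
    rw [ih x.2 (by rintro h; rw [h, mul_zero] at hx2; exact hn hx2.1.symm), AK_apply]

end Counting

section Degree

lemma two_top {L : Type} [Field L] [NumberField L] [alg : Algebra ℚ L]
    (N M : IntermediateField ℚ L) [NumberField M] [NumberField N] [IsGalois ℚ N]
    (hc : IsCoprime (discr N) (discr M)) (hsup : N ⊔ M = ⊤) :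
    Module.finrank ℚ L = Module.finrank ℚ N * Module.finrank ℚ M ∧
    (discr L).natAbs = (discr N).natAbs ^ Module.finrank ℚ M *
      (discr M).natAbs ^ Module.finrank ℚ N := by
  obtain rfl : alg = DivisionRing.toRatAlgebra := Subsingleton.elim _ _
  have hld := NumberField.linearDisjoint_of_isGalois_isCoprime_discr _ N M hc
  constructor
  · have h1 := hld.finrank_sup
    rw [hsup, IntermediateField.finrank_top'] at h1
    exact h1
  · exact NumberField.natAbs_discr_eq_natAbs_discr_pow_mul_natAbs_discr_pow _ N M hld hsup
      (NumberField.isCoprime_differentIdeal_of_isCoprime_discr _ hc)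

/-- two fields with coprime discriminants, one of them Galois -/
lemma two_fields {E : Type} [Field E] [CharZero E] (M N : IntermediateField ℚ E) [NumberField M] [NumberField N]
    [NumberField ↥(M ⊔ N)] [IsGalois ℚ N]
    (h : IsCoprime (discr M) (discr N)) :
    Module.finrank ℚ ↥(M ⊔ N) = Module.finrank ℚ M * Module.finrank ℚ N ∧
    ∀ x : ℤ, IsCoprime x (discr M) → IsCoprime x (discr N) → IsCoprime x (discr ↥(M ⊔ N)) := by
  let M' := IntermediateField.restrict (le_sup_left : M ≤ M ⊔ N)
  let N' := IntermediateField.restrict (le_sup_right : N ≤ M ⊔ N)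
  let eM : M ≃ₐ[ℚ] M' := IntermediateField.restrictAlgEquiv (le_sup_left : M ≤ M ⊔ N)
  let eN : N ≃ₐ[ℚ] N' := IntermediateField.restrictAlgEquiv (le_sup_right : N ≤ M ⊔ N)
  have : NumberField M' := NumberField.of_ringEquiv _ _ eM.toRingEquiv
  have : NumberField N' := NumberField.of_ringEquiv _ _ eN.toRingEquiv
  have dM : discr M = discr M' := NumberField.discr_eq_discr_of_algEquiv _ eM
  have dN : discr N = discr N' := NumberField.discr_eq_discr_of_algEquiv _ eN
  have : IsGalois ℚ N' := IsGalois.of_algEquiv eN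
  have hc : IsCoprime (discr N') (discr M') := by rw [← dM, ← dN]; exact h.symm
  have hsup : N' ⊔ M' = ⊤ := by
    apply IntermediateField.lift_injective
    rw [IntermediateField.lift_sup, IntermediateField.lift_restrict,
      IntermediateField.lift_restrict, IntermediateField.lift_top, sup_comm]
  obtain ⟨h1, h2⟩ := two_top N' M' hc hsup
  constructor
  · rw [h1, mul_comm, ← eM.toLinearEquiv.finrank_eq, ← eN.toLinearEquiv.finrank_eq]
  · intro x hx hy
    rw [← dM, ← dN] at h2
    rw [Int.isCoprime_iff_gcd_eq_one, Int.gcd_def] at hx hy ⊢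
    rw [h2]
    exact Nat.Coprime.mul_right (Nat.Coprime.pow_right _ hy) (Nat.Coprime.pow_right _ hx)

lemma degree_iSup {ι : Type} [Fintype ι] {E : Type} [Field E] [CharZero E] (K : ι → IntermediateField ℚ E)
    [∀ i, NumberField ↥(K i)] [∀ i, IsGalois ℚ ↥(K i)]
    (hcop : ∀ i j, i ≠ j → IsCoprime (discr ↥(K i)) (discr ↥(K j))) :
    Module.finrank ℚ ↥(⨆ i, K i) = ∏ i, Module.finrank ℚ (K i) := by
  classical
  have key : ∀ s : Finset ι, ∃ M : IntermediateField ℚ E, ∃ _ : NumberField M,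
      M = ⨆ i ∈ s, K i ∧ Module.finrank ℚ M = ∏ i ∈ s, Module.finrank ℚ (K i) ∧
      ∀ x : ℤ, (∀ i ∈ s, IsCoprime x (discr (K i))) → IsCoprime x (discr M) := by
    intro s
    induction s using Finset.induction_on with
    | empty =>
      have : FiniteDimensional ℚ (⊥ : IntermediateField ℚ E) := inferInstance
      have : NumberField (⊥ : IntermediateField ℚ E) := ⟨⟩
      refine ⟨⊥, this, by simp, by simp, fun x _ => ?_⟩
      rw [← NumberField.discr_eq_discr_of_algEquiv ℚ (IntermediateField.botEquiv ℚ E).symm,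
        NumberField.discr_rat]
      exact isCoprime_one_right
    | insert a s ha ih =>
      obtain ⟨M, hM, h1, h2, h3⟩ := ih
      have hc : IsCoprime (discr M) (discr (K a)) :=
        (h3 _ fun i hi => hcop a i (by rintro rfl; exact ha hi)).symm
      have : FiniteDimensional ℚ ↥(M ⊔ K a) := IntermediateField.finiteDimensional_sup _ _
      have : NumberField ↥(M ⊔ K a) := ⟨⟩
      obtain ⟨h4, h5⟩ := two_fields M (K a) hc
      refine ⟨M ⊔ K a, this, ?_, ?_, ?_⟩
      · rw [Finset.iSup_insert, h1, sup_comm]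
      · rw [Finset.prod_insert ha, h4, h2, mul_comm]
      · intro x hx
        exact h5 x (h3 x fun i hi => hx i (Finset.mem_insert_of_mem hi))
          (hx a (Finset.mem_insert_self _ _))
  obtain ⟨M, _, h1, h2, _⟩ := key Finset.univ
  have : M = ⨆ i, K i := by rw [h1]; simp
  rw [← this, h2]

end Degree

section Splitting

variable (K : Type) [Field K] [NumberField K] [IsGalois ℚ K]

/-- the common inertia degree above `p` -/
noncomputable abbrev fD (p : ℕ) : ℕ := (Ideal.span {(p : ℤ)}).inertiaDegIn (𝓞 K)

/-- the common ramification index above `p` -/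
noncomputable abbrev eD (p : ℕ) : ℕ := (Ideal.span {(p : ℤ)}).ramificationIdxIn (𝓞 K)

lemma isPrime_span {p : ℕ} (hp : p.Prime) : (Ideal.span {(p : ℤ)}).IsPrime :=
  (Ideal.span_singleton_prime (by exact_mod_cast hp.ne_zero)).mpr (Nat.prime_iff_prime_int.mp hp)

lemma PO_deg_eq {p : ℕ} (P : PO K p) : P.1.inertiaDeg ℤ = fD K p := by
  have := P.2.1
  have := P.2.2
  exact (Ideal.inertiaDegIn_eq_inertiaDeg _ P.1 Gal(K/ℚ)).symm

lemma card_PO_mul {p : ℕ} (hp : p.Prime) :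
    Fintype.card (PO K p) * (eD K p * fD K p) = Module.finrank ℚ K := by
  have := isPrime_span hp
  have h := Ideal.ncard_primesOver_mul_ramificationIdxIn_mul_inertiaDegIn
    (Ideal.span {(p : ℤ)}) (𝓞 K) Gal(K/ℚ)
  rw [IsGalois.card_aut_eq_finrank] at h
  rw [← h, Set.ncard_eq_toFinset_card', Set.toFinset_card]

lemma fD_pos {p : ℕ} (hp : p.Prime) : 0 < fD K p := by
  have := isPrime_span hp
  exact Nat.pos_of_ne_zero (Ideal.inertiaDegIn_ne_zero Gal(K/ℚ))

lemma nonempty_PO {p : ℕ} (hp : p.Prime) : Nonempty (PO K p) := by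
  have := isPrime_span hp
  infer_instance

lemma card_PO_le {p : ℕ} (hp : p.Prime) : Fintype.card (PO K p) ≤ Module.finrank ℚ K := by
  rw [← card_PO_mul K hp]
  apply Nat.le_mul_of_pos_right
  rcases Nat.eq_zero_or_pos (eD K p * fD K p) with h | h
  · have h1 := card_PO_mul K hp
    rw [h, mul_zero] at h1
    exact absurd h1.symm Module.finrank_pos.ne'
  · exact h

lemma eD_eq_one {p : ℕ} (hp : p.Prime) (h : ¬ (p : ℤ) ∣ discr K) : eD K p = 1 := by
  obtain ⟨P⟩ := nonempty_PO K hp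
  have := P.2.1
  have := P.2.2
  have hpm : P.1.IsMaximal := P.2.1.isMaximal (PO_ne_bot K hp P)
  rw [eD, Ideal.ramificationIdxIn_eq_ramificationIdx _ P.1 Gal(K/ℚ)]
  have h1 := (NumberField.not_dvd_discr_iff_forall_liesOver K (𝓞 K)
    (Nat.prime_iff_prime_int.mp hp)).mp h P.1 hpm P.2.2
  exact Ideal.ramificationIdx_eq_one_iff.mpr h1

lemma locS_AK {p : ℕ} (hp : p.Prime) :
    locS (AK K) p = geomS (fD K p) ^ Fintype.card (PO K p) := by
  ext j
  rw [locS, PowerSeries.coeff_mk, AK_apply, aK_prime_pow K hp]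
  simp_rw [PO_deg_eq K]
  rw [Finset.prod_const, Finset.card_univ]

variable (L : Type) [Field L] [NumberField L] [IsGalois ℚ L] [Algebra K L]

lemma fD_dvd {p : ℕ} (hp : p.Prime) : fD K p ∣ fD L p := by
  obtain ⟨P⟩ := nonempty_PO L hp
  have := P.2.1
  have := P.2.2
  have h1 : (P.1.under (𝓞 K)).LiesOver (Ideal.span {(p : ℤ)}) := inferInstance
  rw [← PO_deg_eq L P, ← PO_deg_eq K (⟨P.1.under (𝓞 K), inferInstance, h1⟩ : PO K p),
    Ideal.inertiaDeg_tower (P.1.under (𝓞 K)) P.1]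
  exact dvd_mul_right _ _

open scoped Pointwise in
lemma restrict_eq_one {p : ℕ} (hp : p.Prime) (h : eD K p * fD K p = 1) (P : PO L p)
    (σ : Gal(L/ℚ)) (hσ : σ • P.1 = P.1) (x : K) : σ (algebraMap K L x) = algebraMap K L x := by
  have := P.2.1
  have := P.2.2
  have := isPrime_span hp
  let τ : Gal(K/ℚ) := AlgEquiv.restrictNormal σ K
  have hτ : ∀ y, algebraMap K L (τ y) = σ (algebraMap K L y) := AlgEquiv.restrictNormal_commutes σ K
  have h1 : (P.1.under (𝓞 K)).LiesOver (Ideal.span {(p : ℤ)}) := inferInstance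
  let Q : PO K p := ⟨P.1.under (𝓞 K), inferInstance, h1⟩
  have hc := Ideal.card_stabilizer_eq (G := Gal(K/ℚ)) (Ideal.span {(p : ℤ)}) (P.1.under (𝓞 K))
  rw [show _ * _ = 1 from h] at hc
  have hle : P.1.under (𝓞 K) ≤ τ⁻¹ • P.1.under (𝓞 K) := by
    intro y hy
    rw [Ideal.mem_inv_pointwise_smul_iff]
    rw [Ideal.under, Ideal.mem_comap] at hy ⊢
    have : algebraMap (𝓞 K) (𝓞 L) (τ • y) = σ • algebraMap (𝓞 K) (𝓞 L) y := by
      ext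
      exact hτ y
    rw [this, ← hσ]
    exact Ideal.smul_mem_pointwise_smul _ _ _ hy
  have hmax : (P.1.under (𝓞 K)).IsMaximal := Q.2.1.isMaximal (PO_ne_bot K hp Q)
  have hpr : (τ⁻¹ • P.1.under (𝓞 K)).IsPrime := inferInstance
  have heq := hmax.eq_of_le hpr.ne_top hle
  have hmem : τ⁻¹ ∈ MulAction.stabilizer Gal(K/ℚ) (P.1.under (𝓞 K)) := heq.symm
  have hbot := Subgroup.card_eq_one.mp hc
  rw [hbot, Subgroup.mem_bot, inv_eq_one] at hmem
  rw [← hτ, hmem]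
  rfl

end Splitting

section SplitAll

open scoped Pointwise in
lemma split_all {ι : Type} (F : ι → Type) [∀ i, Field (F i)] [∀ i, NumberField (F i)]
    [∀ i, IsGalois ℚ (F i)]
    (L : Type) [Field L] [NumberField L] [IsGalois ℚ L] [∀ i, Algebra (F i) L]
    (hgen : ∀ σ : Gal(L/ℚ), (∀ i, ∀ x : F i, σ (algebraMap (F i) L x) = algebraMap (F i) L x) → σ = 1)
    {p : ℕ} (hp : p.Prime) (h : ∀ i, eD (F i) p * fD (F i) p = 1) : eD L p * fD L p = 1 := by
  obtain ⟨P⟩ := nonempty_PO L hp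
  have := P.2.1
  have := P.2.2
  have := isPrime_span hp
  rw [eD, fD, ← Ideal.card_stabilizer_eq (G := Gal(L/ℚ)) (Ideal.span {(p : ℤ)}) P.1,
    Subgroup.card_eq_one, eq_bot_iff]
  intro σ hσ
  rw [Subgroup.mem_bot]
  exact hgen σ fun i x => restrict_eq_one (F i) L hp (h i) P σ hσ x

end SplitAll

section Assembly

lemma geomS_low {f : ℕ} (hf : 0 < f) (g : ℕ) {j : ℕ} (hj : j < f) (hj0 : j ≠ 0) :
    PowerSeries.coeff j (geomS f ^ g) = 0 := by
  have h1 : (PowerSeries.X : PowerSeries ℂ) ^ f ∣ geomS f ^ g - 1 := by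
    have h2 : geomS f - 1 = PowerSeries.X ^ f * geomS f := by
      linear_combination geomS_mul f hf
    refine dvd_trans (h2 ▸ dvd_mul_right _ _) ?_
    simpa using sub_dvd_pow_sub_pow (geomS f) 1 g
  have h3 := PowerSeries.X_pow_dvd_iff.mp h1 j hj
  rw [map_sub, PowerSeries.coeff_one, if_neg hj0, sub_zero] at h3
  exact h3

lemma geomS_one : geomS 1 = PowerSeries.mk 1 := by
  ext j
  simp [geomS]

lemma geomS_one_coeff_one (N : ℕ) : PowerSeries.coeff 1 (geomS 1 ^ N) = (N : ℂ) := by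
  rcases N with _ | N
  · simp [PowerSeries.coeff_one]
  · rw [geomS_one, PowerSeries.mk_one_pow_eq_mk_choose_add, PowerSeries.coeff_mk]
    simp

lemma geomS_one_coeff_two (N : ℕ) :
    PowerSeries.coeff 2 (geomS 1 ^ N) = (((N + 1).choose 2 : ℕ) : ℂ) := by
  rcases N with _ | N
  · simp [PowerSeries.coeff_one]
  · rw [geomS_one, PowerSeries.mk_one_pow_eq_mk_choose_add, PowerSeries.coeff_mk]
    congr 1
    rw [Nat.choose_symm_add]

lemma choose_aux (k d : ℕ) (hd : Odd d) :
    (d * k + 1).choose 2 = d * ((k ^ 2 * d + k) / 2) := by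
  rw [Nat.choose_two_right, ← Nat.mul_div_assoc]
  · congr 1
    simp only [Nat.add_sub_cancel]
    ring
  · have : k ^ 2 * d + k = k * (k * d + 1) := by ring
    rw [this]
    rcases Nat.even_or_odd k with h | h
    · exact (h.mul_right _).two_dvd
    · exact ((h.mul hd).add_odd odd_one |>.mul_left k).two_dvd

lemma PBd_geom (f : ℕ) : PBd (geomS f) 1 0 := by
  intro j
  rw [geomS, PowerSeries.coeff_mk]
  split_ifs <;> simp

lemma PBd_one_sub (f : ℕ) (hf : 0 < f) : PBd (1 - PowerSeries.X ^ f) 1 0 := by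
  intro j
  rw [map_sub, PowerSeries.coeff_one, PowerSeries.coeff_X_pow]
  split_ifs with h1 h2
  · omega
  all_goals simp

section
variable (K : Type) [Field K] [NumberField K] [IsGalois ℚ K]

lemma PBd_AK {p : ℕ} (hp : p.Prime) : PBd (locS (AK K) p) 1 (Module.finrank ℚ K) := by
  rw [locS_AK K hp]
  refine ((PBd_geom _).pow _).mono zero_le_one ?_
  simpa using card_PO_le K hp

lemma PBd_inv {p : ℕ} (hp : p.Prime) :
    PBd ((1 - PowerSeries.X ^ fD K p) ^ Fintype.card (PO K p)) 1 (Module.finrank ℚ K) := by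
  refine ((PBd_one_sub _ (fD_pos K hp)).pow _).mono zero_le_one ?_
  simpa using card_PO_le K hp

/-- the value at `p²` of the divisor function, for unramified `p` -/
lemma tau_unram {p : ℕ} (hp : p.Prime) (he : eD K p = 1) (hodd : Odd (Module.finrank ℚ K)) (k : ℕ) :
    (fD K p = 1 → PowerSeries.coeff 2 (locS (AK K) p ^ k) =
      ((Module.finrank ℚ K * ((k ^ 2 * Module.finrank ℚ K + k) / 2) : ℕ) : ℂ)) ∧
    (fD K p ≠ 1 → PowerSeries.coeff 2 (locS (AK K) p ^ k) = 0) := by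
  have hc := card_PO_mul K hp
  rw [he, one_mul] at hc
  rw [locS_AK K hp, ← pow_mul]
  constructor
  · intro hf
    rw [hf, mul_one] at hc
    rw [hf, hc, geomS_one_coeff_two, choose_aux _ _ hodd]
  · intro hf
    have ho : Odd (fD K p) := by
      rw [← hc] at hodd
      exact (Nat.odd_mul.mp hodd).2
    have : 2 < fD K p := by
      obtain ⟨t, ht⟩ := ho
      omega
    exact geomS_low (by omega) _ this (by norm_num)

end

/-- the arithmetic function `∏ τ(n²)` -/
noncomputable def fS {ι : Type} [Fintype ι] (F : ι → Type) [∀ i, Field (F i)]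
    [∀ i, NumberField (F i)] (k : ι → ℕ) : ArithmeticFunction ℂ :=
  ⟨fun n => if n = 0 then 0 else ∏ i, (AK (F i) ^ k i) (n ^ 2), by simp⟩

lemma fS_apply {ι : Type} [Fintype ι] (F : ι → Type) [∀ i, Field (F i)]
    [∀ i, NumberField (F i)] (k : ι → ℕ) {n : ℕ} (hn : n ≠ 0) :
    fS F k n = ∏ i, (AK (F i) ^ k i) (n ^ 2) := by
  simp [fS, hn]

lemma fS_mult {ι : Type} [Fintype ι] (F : ι → Type) [∀ i, Field (F i)]
    [∀ i, NumberField (F i)] (k : ι → ℕ) : (fS F k).IsMultiplicative := by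
  rw [ArithmeticFunction.IsMultiplicative.iff_ne_zero]
  constructor
  · rw [fS_apply _ _ one_ne_zero]
    refine Finset.prod_eq_one fun i _ => ?_
    rw [one_pow]
    exact (isMult_pow (AK_mult (F i)) (k i)).map_one
  · intro m n hm hn h
    rw [fS_apply _ _ hm, fS_apply _ _ hn, fS_apply _ _ (mul_ne_zero hm hn), ← Finset.prod_mul_distrib]
    refine Finset.prod_congr rfl fun i _ => ?_
    rw [mul_pow]
    exact (isMult_pow (AK_mult (F i)) (k i)).map_mul_of_coprime (Nat.Coprime.pow 2 2 h)

lemma fS_prime_pow {ι : Type} [Fintype ι] (F : ι → Type) [∀ i, Field (F i)]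
    [∀ i, NumberField (F i)] (k : ι → ℕ) {p : ℕ} (hp : p.Prime) (j : ℕ) :
    fS F k (p ^ j) = ∏ i, PowerSeries.coeff (2 * j) (locS (AK (F i)) p ^ k i) := by
  rw [fS_apply _ _ (pow_ne_zero _ hp.ne_zero)]
  refine Finset.prod_congr rfl fun i _ => ?_
  rw [← locS_pow _ hp, locS, PowerSeries.coeff_mk, ← pow_mul, mul_comm]

lemma PBd_fS {ι : Type} [Fintype ι] (F : ι → Type) [∀ i, Field (F i)]
    [∀ i, NumberField (F i)] [∀ i, IsGalois ℚ (F i)] (k : ι → ℕ) :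
    ∃ C : ℝ, 0 ≤ C ∧ ∃ E : ℕ, ∀ p : ℕ, p.Prime → PBd (locS (fS F k) p) C E := by
  let E : ι → ℕ := fun i => k i * (Module.finrank ℚ (F i) + 1)
  refine ⟨2 ^ (∑ i, E i), by positivity, ∑ i, E i, fun p hp j => ?_⟩
  rw [locS, PowerSeries.coeff_mk, fS_prime_pow _ _ hp, norm_prod, ← mul_pow,
    ← Finset.prod_pow_eq_pow_sum]
  refine Finset.prod_le_prod (fun _ _ => norm_nonneg _) fun i _ => ?_
  refine ((PBd_AK (F i) hp).pow (k i) (2 * j)).trans ?_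
  rw [one_mul]
  refine pow_le_pow_left₀ (by positivity) ?_ _
  push_cast
  linarith

lemma LSeries_pow {A : ArithmeticFunction ℂ} {s : ℂ} (h : LSeriesSummable (fun n => A n) s) (m : ℕ) :
    LSeriesSummable (fun n => (A ^ m) n) s ∧
      LSeries (fun n => (A ^ m) n) s = LSeries (fun n => A n) s ^ m := by
  induction m with
  | zero =>
    have h1 : LSeriesSummable (fun n => (1 : ArithmeticFunction ℂ) n) s := by
      refine summable_of_hasFiniteSupport ((Set.finite_singleton 1).subset ?_)
      intro n hn
      by_contra h
      apply hn
      have h' : n ≠ 1 := h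
      rcases eq_or_ne n 0 with rfl | h0
      · simp
      · simp [LSeries.term_def, h']
    refine ⟨by simpa using h1, ?_⟩
    rw [pow_zero, pow_zero]
    rw [ArithmeticFunction.one_eq_delta, LSeries_delta]
    rfl
  | succ m ih =>
    rw [pow_succ, pow_succ]
    exact ⟨ArithmeticFunction.LSeriesSummable_mul ih.1 h,
      by rw [ArithmeticFunction.LSeries_mul' ih.1 h, ih.2]⟩

theorem main_abstract {ι : Type} [Fintype ι] (F : ι → Type) [∀ i, Field (F i)]
    [∀ i, NumberField (F i)] [∀ i, IsGalois ℚ (F i)]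
    (L : Type) [Field L] [NumberField L] [IsGalois ℚ L] [∀ i, Algebra (F i) L]
    (hgen : ∀ σ : Gal(L/ℚ), (∀ i, ∀ x : F i, σ (algebraMap (F i) L x) = algebraMap (F i) L x) → σ = 1)
    (hdeg : Module.finrank ℚ L = ∏ i, Module.finrank ℚ (F i))
    (hodd : ∀ i, Odd (Module.finrank ℚ (F i))) (k : ι → ℕ) (m : ℕ)
    (hm : m = ∏ i, (k i ^ 2 * Module.finrank ℚ (F i) + k i) / 2) :
    ∃ u : ℕ → ℂ,
      (∀ s : ℂ, 1 / 2 < s.re → LSeriesSummable u s) ∧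
      ∀ s : ℂ, 1 < s.re →
        LSeries (fun n => ∏ i, (tauK (F i) (k i) (n ^ 2) : ℂ)) s
          = dzeta L s ^ m * LSeries u s := by
  obtain ⟨B, hBm, hBl, hAB⟩ := exists_dirichlet_inverse (AK L) (AK_mult L)
    (fun p => (1 - PowerSeries.X ^ fD L p) ^ Fintype.card (PO L p))
    (fun p hp => by
      have := (fD_pos L hp).ne'
      simp [this])
    (fun p hp => by
      rw [locS_AK L hp, ← mul_pow, geomS_mul _ (fD_pos L hp), one_pow])
  set u : ArithmeticFunction ℂ := fS F k * B ^ m with hu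
  have hum : u.IsMultiplicative := (fS_mult F k).mul (isMult_pow hBm m)
  have hfac : fS F k = AK L ^ m * u := by
    rw [hu, mul_left_comm, ← mul_pow, hAB, one_pow, mul_one]
  -- bounds
  obtain ⟨C, hC, E, hE⟩ := PBd_fS F k
  have hub : ∀ p, p.Prime → PBd (locS u p) (C * 1) (E + m * (Module.finrank ℚ L + 1) + 1) := by
    intro p hp
    rw [hu, locS_mul _ _ hp, locS_pow _ hp, hBl p hp]
    exact (hE p hp).mul hC ((PBd_inv L hp).pow m)
  -- vanishing
  have hvan : ∀ p : ℕ, p.Prime → (∀ i, ¬ (p : ℤ) ∣ discr (F i)) → u p = 0 := by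
    intro p hp hd
    have he : ∀ i, eD (F i) p = 1 := fun i => eD_eq_one (F i) hp (hd i)
    have h1 : fS F k p = PowerSeries.coeff 1 (locS (AK L) p ^ m) + u p := by
      have h2 := congrArg (fun g => PowerSeries.coeff 1 (locS g p)) hfac
      simp only [locS_mul _ _ hp, locS_pow _ hp] at h2
      rw [PowerSeries.coeff_mul, Finset.Nat.antidiagonal_succ] at h2
      have e1 : PowerSeries.coeff 1 (locS (fS F k) p) = fS F k p := by simp [locS]
      have e2 : PowerSeries.coeff 1 (locS u p) = u p := by simp [locS]
      have e3 : PowerSeries.coeff 0 (locS u p) = 1 := by simp [locS, hum.map_one]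
      have e4 : PowerSeries.coeff 0 (locS (AK L) p ^ m) = 1 := by
        rw [PowerSeries.coeff_zero_eq_constantCoeff_apply, map_pow,
          ← PowerSeries.coeff_zero_eq_constantCoeff_apply]
        simp [locS, (AK_mult L).map_one]
      simp only [Finset.Nat.antidiagonal_zero, Finset.sum_cons, Finset.map_singleton,
        Finset.sum_singleton] at h2
      simp only [Function.Embedding.prodMap, Function.Embedding.coeFn_mk, Prod.map] at h2
      simp [e1, e2, e3, e4] at h2
      rw [h2]; ring
    have h3 := fS_prime_pow F k hp 1
    rw [pow_one, mul_one] at h3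
    rw [h3, locS_AK L hp, ← pow_mul] at h1
    by_cases hs : ∀ i, fD (F i) p = 1
    · have h4 := split_all F L hgen hp (fun i => by rw [he, hs])
      have h5 : fD L p = 1 := Nat.eq_one_of_mul_eq_one_left h4
      have h6 := card_PO_mul L hp
      rw [h4, mul_one, hdeg] at h6
      rw [h5, geomS_one_coeff_one, h6,
        Finset.prod_congr rfl fun i _ => (tau_unram (F i) hp (he i) (hodd i) (k i)).1 (hs i),
        ← Nat.cast_prod, Finset.prod_mul_distrib, ← hm] at h1
      exact (left_eq_add.mp h1)
    · push Not at hs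
      obtain ⟨i, hi⟩ := hs
      have h5 : 1 < fD L p := by
        have h6 := Nat.le_of_dvd (fD_pos L hp) (fD_dvd (F i) L hp)
        have := fD_pos (F i) hp
        omega
      rw [geomS_low (by omega) _ h5 one_ne_zero, zero_add, Finset.prod_eq_zero (Finset.mem_univ i)
        ((tau_unram (F i) hp (he i) (hodd i) (k i)).2 hi)] at h1
      exact h1.symm
  have hus : ∀ s : ℂ, 1 / 2 < s.re → LSeriesSummable (fun n => u n) s := by
    intro s hs
    refine lseriesSummable_of_real u s (summable_crit u hum (C * 1)
      (E + m * (Module.finrank ℚ L + 1) + 1) (by positivity)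
      (fun p hp j => ?_) s.re hs ?_)
    · have := hub p hp j
      rw [locS, PowerSeries.coeff_mk] at this
      exact this
    · have hD : (∏ i, discr (F i)) ≠ 0 := Finset.prod_ne_zero_iff.mpr fun i _ => discr_ne_zero _
      refine summable_of_hasFiniteSupport
        ((Set.finite_Iic (∏ i, discr (F i)).natAbs).subset fun p hp => ?_)
      rw [Function.mem_support] at hp
      have hpp : p.Prime := by
        by_contra h; simp [h] at hp
      by_contra hle
      apply hp
      rw [if_pos hpp, hvan p hpp, norm_zero, zero_mul]
      intro i hi
      apply hle
      rw [Set.mem_Iic]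
      refine Nat.le_of_dvd (Int.natAbs_pos.mpr hD) ?_
      rw [← Int.natCast_dvd]
      exact hi.trans (Finset.dvd_prod_of_mem _ (Finset.mem_univ i))
  have hAs : ∀ s : ℂ, 1 < s.re → LSeriesSummable (fun n => AK L n) s := by
    intro s hs
    have hb : ∀ p : ℕ, p.Prime → ∀ j : ℕ, ‖AK L (p ^ j)‖ ≤ 1 * ((j : ℝ) + 1) ^ Module.finrank ℚ L := by
      intro p hp j
      have := PBd_AK L hp j
      rw [locS, PowerSeries.coeff_mk] at this
      exact this
    refine lseriesSummable_of_real _ s (summable_crit _ (AK_mult L) 1 _ zero_le_one hb s.re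
      (by linarith) ?_)
    have h1 : Summable fun p : ℕ => (2 : ℝ) ^ Module.finrank ℚ L * (p : ℝ) ^ (-s.re) :=
      (Real.summable_nat_rpow.mpr (by linarith)).mul_left _
    refine Summable.of_nonneg_of_le (fun p => ?_) (fun p => ?_) h1
    · split_ifs <;> positivity
    · split_ifs with hp
      · have := hb p hp 1
        rw [pow_one, one_mul, Nat.cast_one, one_add_one_eq_two] at this
        gcongr
      · positivity
  refine ⟨fun n => u n, hus, fun s hs => ?_⟩
  obtain ⟨h1, h2⟩ := LSeries_pow (hAs s hs) m
  have h3 := ArithmeticFunction.LSeries_mul' h1 (hus s (by linarith))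
  rw [← hfac, h2] at h3
  refine (LSeries_congr (fun {n} hn => ?_) s).trans h3
  rw [fS_apply _ _ hn]
  exact Finset.prod_congr rfl fun i _ => (AK_pow_apply (F i) (k i) _ (pow_ne_zero _ hn)).symm

end Assembly

/-- **Factorization of the Dirichlet series of `τ_{k₁}^{K₁}(n²) ⋯ τ_{k_l}^{K_l}(n²)`.**
With `K₁, …, K_l ⊆ ℚ̄` Galois over `ℚ` of odd degrees `dᵢ ≥ 3`, pairwise coprime
discriminants, `kᵢ ≥ 2`, and `m = ∏ i (kᵢ² dᵢ + kᵢ)/2`, there is a Dirichlet series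
`U(s) = ∑ uₙ n^{-s}` absolutely convergent for `Re s > 1/2` such that
`∑ τ_{k₁}^{K₁}(n²) ⋯ τ_{k_l}^{K_l}(n²) n^{-s} = ζ_{K₁⋯K_l}(s)^m · U(s)` for `Re s > 1`. -/
theorem dirichlet_series_tau_squares_factorization
    (l : ℕ) (hl : 1 ≤ l)
    (k : Fin l → ℕ) (hk : ∀ i, 2 ≤ k i)
    (K : Fin l → IntermediateField ℚ (AlgebraicClosure ℚ))
    [∀ i, NumberField ↥(K i)] [∀ i, IsGalois ℚ ↥(K i)]
    [NumberField ↥(⨆ i, K i)]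
    (d : Fin l → ℕ) (hd : ∀ i, d i = Module.finrank ℚ ↥(K i))
    (hodd : ∀ i, Odd (d i)) (hd3 : ∀ i, 3 ≤ d i)
    (hcop : ∀ i j, i ≠ j →
      IsCoprime (NumberField.discr ↥(K i)) (NumberField.discr ↥(K j)))
    (m : ℕ) (hm : m = ∏ i, (k i ^ 2 * d i + k i) / 2) :
    ∃ u : ℕ → ℂ,
      (∀ s : ℂ, 1 / 2 < s.re → LSeriesSummable u s) ∧
      ∀ s : ℂ, 1 < s.re →
        LSeries (fun n => ∏ i, (tauK ↥(K i) (k i) (n ^ 2) : ℂ)) s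
          = dzeta ↥(⨆ i, K i) s ^ m * LSeries u s := by
  have hnormal : ∀ i, Normal ℚ ↥(K i) := fun i => IsGalois.to_normal
  have hrat : ∀ i, @IsGalois ℚ _ ↥(K i) _ DivisionRing.toRatAlgebra := by
    intro i
    convert (inferInstance : IsGalois ℚ ↥(K i))
  have hnormal2 : ∀ i, @Normal ℚ ↥(K i) _ _ (K i).algebra' := by
    intro i
    convert hnormal i
    exact Subsingleton.elim _ _
  have hn : Normal ℚ ↥(⨆ i, K i) := by
    convert IntermediateField.normal_iSup ℚ (AlgebraicClosure ℚ) K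
    exact Subsingleton.elim _ _
  have hgal : IsGalois ℚ ↥(⨆ i, K i) := IsGalois.mk
  have hL : @IsGalois ℚ _ ↥(⨆ i, K i) _ DivisionRing.toRatAlgebra := by
    convert hgal
  have hle : ∀ i, K i ≤ ⨆ i, K i := fun i => le_iSup K i
  let _ : ∀ i, Algebra ↥(K i) ↥(⨆ i, K i) := fun i =>
    (IntermediateField.inclusion (hle i)).toRingHom.toAlgebra
  have hdeg := degree_iSup K hcop
  simp only [hd] at hm hodd
  refine main_abstract (fun i => ↥(K i)) ↥(⨆ i, K i) (fun σ hσ => ?_) ?_ ?_ k m ?_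
  · have hrange : ∀ x : ↥(⨆ i, K i), σ x = x := by
      let S₀ : Subfield (AlgebraicClosure ℚ) :=
        (RingHom.eqLocusField (σ : ↥(⨆ i, K i) →+* ↥(⨆ i, K i)) (RingHom.id _)).map
          (algebraMap ↥(⨆ i, K i) (AlgebraicClosure ℚ))
      let S : IntermediateField ℚ (AlgebraicClosure ℚ) := S₀.toIntermediateField fun q => by
        simp
      have hS : (⨆ i, K i) ≤ S := by
        refine iSup_le fun i y hy => ?_
        exact ⟨⟨y, hle i hy⟩, hσ i ⟨y, hy⟩, rfl⟩
      rintro ⟨x, hx⟩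
      obtain ⟨z, hz, hzx⟩ := hS hx
      have hz' : z = ⟨x, hx⟩ := Subtype.ext hzx
      rw [← hz']
      exact hz
    exact AlgEquiv.ext hrange
  · convert hdeg
  · intro i
    convert hodd i
  · convert hm
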